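/- arXiv:1009.1454 — 6 statements merged into one kernel-verified Lean document; each statement's English description precedes it below -/
import Mathlib

section
/- Let R be a Noetherian domain of prime characteristic p, let P be a prime ideal of the perfect closure R^∞, and set 𝔭 := P ∩ R. Then the map φ : (R_𝔭)^∞ → (R^∞)_P which sends an element x with x^{p^n} = a/b (a ∈ R, b ∈ R∖𝔭) to a^{1/p^n}/b^{1/p^n} is a well-defined injective ring homomorphism which is moreover surjective; hence (R_𝔭)^∞ ≅ (R^∞)_P. -/
theorem IsLocalization.perfectRing {A : Type*} [CommRing A] (p : ℕ) [ExpChar A p] [PerfectRing A p]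
    (S : Submonoid A) (hS : ∀ s : A, s ^ p ∈ S → s ∈ S)
    (B : Type*) [CommRing B] [Algebra A B] [IsLocalization S B] [ExpChar B p] [IsReduced B] :
    PerfectRing B p := by
  refine PerfectRing.ofSurjective B p fun x => ?_
  obtain ⟨a, s, rfl⟩ := IsLocalization.exists_mk'_eq S x
  obtain ⟨b, hb⟩ := surjective_frobenius A p a
  obtain ⟨t, ht⟩ := surjective_frobenius A p (s : A)
  rw [frobenius_def] at hb ht
  refine ⟨IsLocalization.mk' B b ⟨t, hS t (ht ▸ s.2)⟩, ?_⟩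
  rw [frobenius_def, ← IsLocalization.mk'_pow, hb]
  congr 1
  exact Subtype.ext ht

theorem IsLocalization.isPRadical_map {A A' : Type*} [CommRing A] [CommRing A']
    (i : A →+* A') (p : ℕ) [IsPRadical i p] (hi : Function.Injective i)
    (S : Submonoid A) (T : Submonoid A') (hST : S = T.comap i)
    (B B' : Type*) [CommRing B] [Algebra A B] [IsLocalization S B]
    [CommRing B'] [Algebra A' B'] [IsLocalization T B'] (hp : p.Prime) :
    IsPRadical (IsLocalization.map B' i hST.le : B →+* B') p where
  pow_mem' x := by
    obtain ⟨a, s, rfl⟩ := IsLocalization.exists_mk'_eq T x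
    obtain ⟨n, a', ha⟩ := IsPRadical.pow_mem i p a
    obtain ⟨m, s', hs⟩ := IsPRadical.pow_mem i p (s : A')
    have hs' : s' ^ p ^ n ∈ S := by
      rw [hST, Submonoid.mem_comap, map_pow, hs]
      exact pow_mem (pow_mem s.2 _) _
    refine ⟨n + m, IsLocalization.mk' B (a' ^ p ^ m) ⟨_, hs'⟩, ?_⟩
    rw [IsLocalization.map_mk', ← IsLocalization.mk'_pow]
    congr 1
    · rw [map_pow, ha, ← pow_mul, pow_add]
    · ext
      simp only [map_pow, hs, SubmonoidClass.coe_pow]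
      rw [← pow_mul, pow_add, mul_comm]
  ker_le' x hx := by
    obtain ⟨a, s, rfl⟩ := IsLocalization.exists_mk'_eq S x
    rw [RingHom.mem_ker, IsLocalization.map_mk', IsLocalization.mk'_eq_zero_iff] at hx
    obtain ⟨u, hu⟩ := hx
    obtain ⟨n, u', hu'⟩ := IsPRadical.pow_mem i p (u : A')
    have hmem : u' ∈ S := by
      rw [hST, Submonoid.mem_comap, hu']
      exact pow_mem u.2 _
    have hzero : u' * a ^ p ^ n = 0 := by
      apply hi
      rw [map_mul, hu', map_pow, ← mul_pow, hu, map_zero, zero_pow (pow_ne_zero n hp.ne_zero)]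
    rw [mem_pNilradical]
    refine ⟨n, ?_⟩
    rw [← IsLocalization.mk'_pow, IsLocalization.mk'_eq_zero_iff]
    exact ⟨⟨u', hmem⟩, hzero⟩

theorem PerfectClosure.of_injective (R : Type*) [CommRing R] [IsReduced R]
    (p : ℕ) [Fact p.Prime] [CharP R p] : Function.Injective (PerfectClosure.of R p) := by
  intro x y h
  simpa [PerfectClosure.of_apply, PerfectClosure.eq_iff] using h

/-!
STATEMENT 5: Let `R` be a Noetherian domain of prime characteristic `p`, let `P`
be a prime ideal of the perfect closure `R^∞`, and set `𝔭 := P ∩ R`.  Then the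
map `φ : (R_𝔭)^∞ → (R^∞)_P` (sending `x` with `x^{p^n} = a/b` to
`a^{1/p^n}/b^{1/p^n}`) is a well-defined bijective ring homomorphism; hence
`(R_𝔭)^∞ ≅ (R^∞)_P`.  The map is characterized as the unique ring isomorphism
compatible with the canonical maps from `R`.
-/

theorem perfectClosure_localization_iso
    (R : Type u) [CommRing R] [IsDomain R] [IsNoetherianRing R]
    (p : ℕ) [Fact p.Prime] [CharP R p]
    (P : Ideal (PerfectClosure R p)) [P.IsPrime]
    (𝔭 : Ideal R) (h𝔭 : 𝔭 = P.comap (PerfectClosure.of R p)) [𝔭.IsPrime]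
    [CharP (Localization.AtPrime 𝔭) p] :
    ∃ φ : PerfectClosure (Localization.AtPrime 𝔭) p ≃+* Localization.AtPrime P,
      ∀ r : R,
        φ (PerfectClosure.of (Localization.AtPrime 𝔭) p
            (algebraMap R (Localization.AtPrime 𝔭) r)) =
          algebraMap (PerfectClosure R p) (Localization.AtPrime P)
            (PerfectClosure.of R p r) := by
  have hp : p.Prime := Fact.out
  have hcomap : 𝔭.primeCompl = P.primeCompl.comap (PerfectClosure.of R p) := by
    subst h𝔭
    rfl
  have : CharP (Localization.AtPrime P) p := by
    rw [CharP.charP_iff_prime_eq_zero hp,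
      ← map_natCast (algebraMap (PerfectClosure R p) (Localization.AtPrime P)),
      CharP.cast_eq_zero, map_zero]
  have : IsReduced (Localization.AtPrime P) :=
    isReduced_localizationPreserves P.primeCompl (Localization.AtPrime P) inferInstance
  have : PerfectRing (Localization.AtPrime P) p :=
    IsLocalization.perfectRing p P.primeCompl
      (fun _ hs hsP => hs (P.pow_mem_of_mem hsP p hp.pos)) _
  let j : Localization.AtPrime 𝔭 →+* Localization.AtPrime P :=
    IsLocalization.map _ (PerfectClosure.of R p) hcomap.le
  have : IsPRadical j p :=
    IsLocalization.isPRadical_map (PerfectClosure.of R p) p (PerfectClosure.of_injective R p)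
      𝔭.primeCompl P.primeCompl hcomap _ _ hp
  refine ⟨IsPerfectClosure.equiv (PerfectClosure.of (Localization.AtPrime 𝔭) p) j p, fun r => ?_⟩
  rw [IsPerfectClosure.equiv_comp_apply]
  exact IsLocalization.map_eq hcomap.le r
end

section
/- Let A be a perfect domain of prime characteristic p (i.e., the Frobenius endomorphism of A is bijective) equipped with a normalized value map v, and let 𝔞 be a nonzero radical ideal of A. Then 𝔞^v = A, where 𝔞^v = {x ∈ A : for every ε > 0 there exists a ∈ A with v(a) < ε and ax ∈ 𝔞}. -/
/-!
STATEMENT 9: Let `A` be a perfect domain of prime characteristic `p` (Frobenius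
bijective) equipped with a normalized value map `v`, and let `𝔞` be a nonzero
radical ideal of `A`.  Then `𝔞^v = A`, where
`𝔞^v = {x ∈ A : ∀ ε > 0, ∃ a ∈ A, v(a) < ε and a·x ∈ 𝔞}`.
-/

structure IsValueMap {A : Type*} [CommRing A] (v : A → WithTop ℝ) : Prop where
  map_mul : ∀ a b : A, v (a * b) = v a + v b
  min_le_add : ∀ a b : A, min (v a) (v b) ≤ v (a + b)
  eq_top_iff : ∀ a : A, v a = ⊤ ↔ a = 0

def IsNormalizedValueMap {A : Type*} [CommRing A] (v : A → WithTop ℝ) : Prop :=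
  IsValueMap v ∧ (∀ a : A, 0 ≤ v a) ∧ (∀ a : A, ¬ IsUnit a → 0 < v a)

theorem IsValueMap.map_pow_succ {A : Type*} [CommRing A] {v : A → WithTop ℝ}
    (hv : IsValueMap v) (a : A) (n : ℕ) : v (a ^ (n + 1)) = (n + 1) • v a := by
  induction n with
  | zero => simp
  | succ n ih => rw [pow_succ, hv.map_mul, ih, succ_nsmul _ (n + 1)]

/-- In a perfect ring of characteristic `p`, a nonzero element has roots of arbitrarily small value. -/
theorem IsValueMap.exists_pow_eq_lt {A : Type*} [CommRing A]
    (p : ℕ) [Fact p.Prime] [CharP A p] [PerfectRing A p] {v : A → WithTop ℝ}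
    (hv : IsValueMap v) {a : A} (ha : a ≠ 0) {ε : ℝ} (hε : 0 < ε) :
    ∃ (b : A) (n : ℕ), b ^ n = a ∧ v b < (ε : WithTop ℝ) := by
  have hp : 1 < p := (Fact.out : p.Prime).one_lt
  obtain ⟨r, hr⟩ := WithTop.ne_top_iff_exists.mp (mt (hv.eq_top_iff a).mp ha)
  obtain ⟨n, hn⟩ := pow_unbounded_of_one_lt (r / ε) (by exact_mod_cast hp : (1 : ℝ) < p)
  obtain ⟨b, hb⟩ := (bijective_iterateFrobenius A p n).2 a
  rw [iterateFrobenius_def] at hb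
  have hb0 : b ≠ 0 := by
    rintro rfl
    exact ha (by rw [← hb, zero_pow (pow_pos (zero_lt_one.trans hp) n).ne'])
  obtain ⟨s, hs⟩ := WithTop.ne_top_iff_exists.mp (mt (hv.eq_top_iff b).mp hb0)
  refine ⟨b, p ^ n, hb, ?_⟩
  obtain ⟨m, hm⟩ := Nat.exists_eq_succ_of_ne_zero (pow_pos (zero_lt_one.trans hp) n).ne'
  have hrs : r = (p : ℝ) ^ n * s := by
    have h := hv.map_pow_succ b m
    rw [← Nat.succ_eq_add_one, ← hm, hb, ← hr, ← hs, ← WithTop.coe_nsmul, WithTop.coe_inj] at h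
    simpa using h
  rw [div_lt_iff₀ hε, hrs] at hn
  rw [← hs, WithTop.coe_lt_coe]
  exact lt_of_mul_lt_mul_left hn (by positivity)

/-- In a perfect domain of characteristic `p` with a normalized value map, the
almost closure of a nonzero radical ideal is everything. -/
theorem vclosure_of_radical_ideal_eq_univ
    (A : Type u) [CommRing A] [IsDomain A]
    (p : ℕ) [Fact p.Prime] [CharP A p] [PerfectRing A p]
    (v : A → WithTop ℝ) (hv : IsNormalizedValueMap v)
    (𝔞 : Ideal A) (hne : 𝔞 ≠ ⊥) (hrad : 𝔞.radical = 𝔞) :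
    {x : A | ∀ ε : ℝ, 0 < ε → ∃ a : A, v a < (ε : WithTop ℝ) ∧ a * x ∈ 𝔞} =
      Set.univ := by
  refine Set.eq_univ_of_forall fun x ε hε => ?_
  obtain ⟨a, ha, ha0⟩ := Submodule.exists_mem_ne_zero_of_ne_bot hne
  obtain ⟨b, n, hb, hlt⟩ := hv.1.exists_pow_eq_lt p ha0 hε
  have hmem : b ∈ 𝔞 := hrad ▸ ⟨n, hb.symm ▸ ha⟩
  exact ⟨b, hlt, 𝔞.mul_mem_right x hmem⟩
end

section
/- Let (R,𝔪) be a Noetherian local domain and let A be a local domain containing R with a normalized value map v : A → ℝ ∪ {∞}. Let M, M′ be finitely generated R-modules and N, W submodules of M. Then: (i) N^𝐯_M is a submodule of M containing N; (ii) (N^𝐯_M)^𝐯_M = N^𝐯_M; (iii) if N ⊆ W ⊆ M then N^𝐯_M ⊆ W^𝐯_M; (iv) for every R-module homomorphism f : M → M′ one has f(N^𝐯_M) ⊆ f(N)^𝐯_{M′}; (v) if N^𝐯_M = N then 0^𝐯_{M/N} = 0. -/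
open scoped TensorProduct

/-- The `v`-closure of a subset `N` of an `A`-module: elements annihilated into `N`
by elements of arbitrarily small positive order. -/
def vClosure {A : Type*} [CommRing A] (v : A → WithTop ℝ)
    {M : Type*} [AddCommGroup M] [Module A M] (N : Set M) : Set M :=
  {x | ∀ ε : ℝ, 0 < ε → ∃ a : A, v a < (ε : WithTop ℝ) ∧ a • x ∈ N}

/-- The dagger closure `N^𝐯_M` of a submodule `N ⊆ M` of an `R`-module with
respect to the `R`-algebra `A` with value map `v`:
`x ∈ N^𝐯_M` iff `1 ⊗ x ∈ (im (A ⊗ N → A ⊗ M))^v`. -/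
def daggerClosure (R A : Type*) [CommRing R] [CommRing A] [Algebra R A]
    (v : A → WithTop ℝ) {M : Type*} [AddCommGroup M] [Module R M]
    (N : Submodule R M) : Set M :=
  {x | (1 : A) ⊗ₜ[R] x ∈ vClosure v (Set.range (LinearMap.lTensor A N.subtype))}

namespace IsNormalizedValueMap

variable {A : Type*} [CommRing A] {v : A → WithTop ℝ}

theorem map_one [Nontrivial A] (hv : IsNormalizedValueMap v) : v 1 = 0 := by
  have htop : v 1 ≠ ⊤ := fun h => one_ne_zero ((hv.1.eq_top_iff 1).1 h)
  have hmul := hv.1.map_mul 1 1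
  rw [mul_one] at hmul
  lift v 1 to ℝ using htop with r
  norm_cast at hmul ⊢
  linarith

theorem map_mul_lt (hv : IsNormalizedValueMap v) {a b : A} {ε : ℝ}
    (ha : v a < ((ε / 2 : ℝ) : WithTop ℝ)) (hb : v b < ((ε / 2 : ℝ) : WithTop ℝ)) :
    v (a * b) < (ε : WithTop ℝ) := by
  rw [hv.1.map_mul]
  lift v a to ℝ using ha.ne_top with r
  lift v b to ℝ using hb.ne_top with s
  norm_cast at ha hb ⊢
  linarith

variable {M : Type*} [AddCommGroup M] [Module A M]

theorem subset_vClosure [Nontrivial A] (hv : IsNormalizedValueMap v) (P : Set M) :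
    P ⊆ vClosure v P := fun x hx ε hε =>
  ⟨1, by rw [hv.map_one]; exact_mod_cast hε, by rwa [one_smul]⟩

/-- The `v`-closure of a submodule, as a submodule. -/
def closureSubmodule [Nontrivial A] (hv : IsNormalizedValueMap v) (P : Submodule A M) :
    Submodule A M where
  carrier := vClosure v (P : Set M)
  zero_mem' := hv.subset_vClosure _ P.zero_mem
  add_mem' := by
    intro x y hx hy ε hε
    obtain ⟨a, ha, hax⟩ := hx (ε / 2) (half_pos hε)
    obtain ⟨b, hb, hby⟩ := hy (ε / 2) (half_pos hε)
    refine ⟨a * b, hv.map_mul_lt ha hb, ?_⟩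
    rw [smul_add]
    refine P.add_mem ?_ ?_
    · rw [mul_comm, mul_smul]
      exact P.smul_mem b hax
    · rw [mul_smul]
      exact P.smul_mem a hby
  smul_mem' := by
    intro c x hx ε hε
    obtain ⟨a, ha, hax⟩ := hx ε hε
    refine ⟨a, ha, ?_⟩
    rw [smul_comm]
    exact P.smul_mem c hax

theorem vClosure_vClosure_subset (hv : IsNormalizedValueMap v) (P : Set M) :
    vClosure v (vClosure v P) ⊆ vClosure v P := by
  intro x hx ε hε
  obtain ⟨a, ha, hax⟩ := hx (ε / 2) (half_pos hε)
  obtain ⟨b, hb, hbx⟩ := hax (ε / 2) (half_pos hε)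
  exact ⟨b * a, hv.map_mul_lt hb ha, by rwa [mul_smul]⟩

end IsNormalizedValueMap

theorem vClosure_mono {A : Type*} [CommRing A] (v : A → WithTop ℝ)
    {M : Type*} [AddCommGroup M] [Module A M] {P Q : Set M} (h : P ⊆ Q) :
    vClosure v P ⊆ vClosure v Q := fun _ hx ε hε =>
  let ⟨a, ha, hax⟩ := hx ε hε
  ⟨a, ha, h hax⟩

section DaggerClosure

variable {R A : Type*} [CommRing R] [CommRing A] [Algebra R A] {v : A → WithTop ℝ}
  {M M' : Type*} [AddCommGroup M] [Module R M] [AddCommGroup M'] [Module R M']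

variable (A) in
/-- The image of `A ⊗ N` in `A ⊗ M`, as an `A`-submodule. -/
def tensorImage (N : Submodule R M) : Submodule A (A ⊗[R] M) :=
  LinearMap.range (N.subtype.baseChange A)

theorem coe_tensorImage (N : Submodule R M) :
    (tensorImage A N : Set (A ⊗[R] M)) = Set.range (LinearMap.lTensor A N.subtype) := rfl

theorem tmul_mem_tensorImage {N : Submodule R M} (a : A) {x : M} (hx : x ∈ N) :
    a ⊗ₜ[R] x ∈ tensorImage A N :=
  ⟨a ⊗ₜ[R] (⟨x, hx⟩ : N), rfl⟩

theorem tensorImage_le_iff {N : Submodule R M} {P : Submodule A (A ⊗[R] M)} :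
    tensorImage A N ≤ P ↔ ∀ x ∈ N, (1 : A) ⊗ₜ[R] x ∈ P := by
  refine ⟨fun h x hx => h (tmul_mem_tensorImage 1 hx), ?_⟩
  rintro h _ ⟨t, rfl⟩
  induction t using TensorProduct.induction_on with
  | zero => simp
  | tmul a y =>
    have := P.smul_mem a (h y y.2)
    rwa [TensorProduct.smul_tmul', smul_eq_mul, mul_one] at this
  | add s t hs ht => rw [map_add]; exact P.add_mem hs ht

theorem daggerClosure_eq_coe_comap [Nontrivial A] (hv : IsNormalizedValueMap v)
    (N : Submodule R M) :
    daggerClosure R A v N =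
      (((hv.closureSubmodule (tensorImage A N)).restrictScalars R).comap
        (TensorProduct.mk R A M 1) : Submodule R M) := rfl

theorem subset_daggerClosure [Nontrivial A] (hv : IsNormalizedValueMap v) (N : Submodule R M) :
    (N : Set M) ⊆ daggerClosure R A v N := fun _ hx =>
  hv.subset_vClosure _ (tmul_mem_tensorImage (A := A) 1 hx)

theorem image_daggerClosure_subset (f : M →ₗ[R] M') {N : Submodule R M} {N' : Submodule R M'}
    (h : N ≤ N'.comap f) : f '' daggerClosure R A v N ⊆ daggerClosure R A v N' := by
  rintro _ ⟨x, hx, rfl⟩ ε hε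
  obtain ⟨a, ha, hax⟩ := hx ε hε
  refine ⟨a, ha, ?_⟩
  rw [← coe_tensorImage] at hax ⊢
  have hle : tensorImage A N ≤ (tensorImage A N').comap (f.baseChange A) :=
    tensorImage_le_iff.2 fun y hy => tmul_mem_tensorImage (A := A) 1 (h hy)
  have := hle hax
  rwa [Submodule.mem_comap, map_smul, LinearMap.baseChange_tmul] at this

theorem daggerClosure_mono {N W : Submodule R M} (h : N ≤ W) :
    daggerClosure R A v N ⊆ daggerClosure R A v W := by
  simpa using image_daggerClosure_subset (A := A) (v := v) LinearMap.id h

theorem daggerClosure_subset_of_subset [Nontrivial A] (hv : IsNormalizedValueMap v)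
    {N K : Submodule R M} (hK : (K : Set M) ⊆ daggerClosure R A v N) :
    daggerClosure R A v K ⊆ daggerClosure R A v N := by
  have hle : tensorImage A K ≤ hv.closureSubmodule (tensorImage A N) :=
    tensorImage_le_iff.2 fun _ hy => hK hy
  exact fun x hx => hv.vClosure_vClosure_subset _ (vClosure_mono v hle hx)

theorem daggerClosure_bot_quotient_subset (N : Submodule R M) :
    daggerClosure R A v (⊥ : Submodule R (M ⧸ N)) ⊆ N.mkQ '' daggerClosure R A v N := by
  intro y hy
  obtain ⟨x, rfl⟩ := N.mkQ_surjective y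
  refine ⟨x, fun ε hε => ?_, rfl⟩
  obtain ⟨a, ha, hax⟩ := hy ε hε
  refine ⟨a, ha, ?_⟩
  have hbot : tensorImage A (⊥ : Submodule R (M ⧸ N)) ≤ ⊥ :=
    tensorImage_le_iff.2 fun z hz => by
      rw [(Submodule.mem_bot R).1 hz, TensorProduct.tmul_zero]; exact zero_mem _
  have hexact : Function.Exact N.subtype N.mkQ := LinearMap.exact_subtype_mkQ N
  exact (lTensor_exact A hexact N.mkQ_surjective _).1 ((Submodule.mem_bot A).1 (hbot hax))

end DaggerClosure

theorem daggerClosure_properties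
    (R : Type u) [CommRing R] [IsNoetherianRing R] [IsLocalRing R] [IsDomain R]
    (A : Type v) [CommRing A] [IsLocalRing A] [IsDomain A] [Algebra R A]
    (hinj : Function.Injective (algebraMap R A))
    (v : A → WithTop ℝ) (hv : IsNormalizedValueMap v)
    (M : Type u) [AddCommGroup M] [Module R M] [Module.Finite R M]
    (M' : Type u) [AddCommGroup M'] [Module R M'] [Module.Finite R M']
    (N W : Submodule R M) :
    -- (i) `N^𝐯_M` is a submodule of `M` containing `N`
    ((N : Set M) ⊆ daggerClosure R A v N ∧
      ∃ Nc : Submodule R M, (Nc : Set M) = daggerClosure R A v N) ∧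
    -- (ii) `(N^𝐯_M)^𝐯_M = N^𝐯_M`
    (∀ Nc : Submodule R M, (Nc : Set M) = daggerClosure R A v N →
      daggerClosure R A v Nc = daggerClosure R A v N) ∧
    -- (iii) monotonicity
    (N ≤ W → daggerClosure R A v N ⊆ daggerClosure R A v W) ∧
    -- (iv) `f(N^𝐯_M) ⊆ f(N)^𝐯_{M′}`
    (∀ f : M →ₗ[R] M',
      f '' daggerClosure R A v N ⊆ daggerClosure R A v (N.map f)) ∧
    -- (v) if `N^𝐯_M = N` then `0^𝐯_{M/N} = 0`
    (daggerClosure R A v N = (N : Set M) →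
      daggerClosure R A v (⊥ : Submodule R (M ⧸ N)) = {(0 : M ⧸ N)}) := by
  refine ⟨⟨subset_daggerClosure hv N, _, (daggerClosure_eq_coe_comap hv N).symm⟩,
    fun Nc hNc => ?_, daggerClosure_mono,
    fun f => image_daggerClosure_subset f (Submodule.le_comap_map f N), fun h => ?_⟩
  · exact (daggerClosure_subset_of_subset hv hNc.le).antisymm
      (hNc ▸ subset_daggerClosure hv Nc)
  · refine Set.Subset.antisymm (fun y hy => ?_) ?_
    · obtain ⟨x, hx, rfl⟩ := daggerClosure_bot_quotient_subset N hy
      rw [h] at hx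
      exact (Submodule.Quotient.mk_eq_zero N).2 hx
    · rw [← Submodule.bot_coe (R := R)]
      exact subset_daggerClosure hv _
end

section
/- Let (R,𝔪) be a Noetherian local domain and let A be a local domain containing R with a normalized value map v : A → ℝ ∪ {∞}, and suppose A is almost Cohen-Macaulay. Let x_1, …, x_{k+1} be a partial system of parameters for R and put J = (x_1, …, x_k)R. Suppose M is a finitely generated R-module, u ∈ M, and f : M → R/J is a surjective R-module homomorphism with f(u) = x̄_{k+1}, the image of x_{k+1} in R/J. Then (Ru)^𝐯_M ∩ ker f ⊆ (Ju)^𝐯_M. -/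
open scoped TensorProduct

/-- System of parameters of a local ring: a sequence of `dim R` elements
generating an ideal whose radical is the maximal ideal. -/
def IsSystemOfParameters (R : Type*) [CommRing R] (xs : List R) : Prop :=
  (xs.length : WithBot ℕ∞) = ringKrullDim R ∧
    (Ideal.span {x | x ∈ xs}).radical.IsMaximal

/-- Almost Cohen-Macaulay algebra over a Noetherian local domain: for every
system of parameters, each element of `((x₁,…,x_{i-1})A : xᵢ)/(x₁,…,x_{i-1})A`
is annihilated by elements of arbitrarily small positive order. -/
def IsAlmostCohenMacaulayAlgebra (R : Type u) [CommRing R]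
    (A : Type v) [CommRing A] [Algebra R A] (v : A → WithTop ℝ) : Prop :=
  ∀ xs : List R, IsSystemOfParameters R xs →
    ∀ (i : ℕ) (hi : i < xs.length) (z : A),
      z * algebraMap R A (xs.get ⟨i, hi⟩) ∈
        Ideal.span (algebraMap R A '' {x | x ∈ xs.take i}) →
      ∀ ε : ℝ, 0 < ε → ∃ a : A, v a < (ε : WithTop ℝ) ∧
        a * z ∈ Ideal.span (algebraMap R A '' {x | x ∈ xs.take i})

/-- An element of the image of `A ⊗ span {u}` in `A ⊗ M` is a pure tensor `c ⊗ u`. -/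
theorem exists_tmul_of_mem_range_lTensor_span_singleton {R A M : Type*} [CommRing R] [CommRing A]
    [Algebra R A] [AddCommGroup M] [Module R M] {u : M} {t : A ⊗[R] M}
    (ht : t ∈ Set.range (LinearMap.lTensor A (Submodule.span R {u}).subtype)) :
    ∃ c : A, t = c ⊗ₜ[R] u := by
  obtain ⟨s, rfl⟩ := ht
  induction s with
  | zero => exact ⟨0, by simp⟩
  | tmul a m =>
    obtain ⟨r, hr⟩ := Submodule.mem_span_singleton.1 m.2
    exact ⟨r • a, by simp [← hr, TensorProduct.smul_tmul]⟩
  | add s t hs ht =>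
    obtain ⟨c, hc⟩ := hs
    obtain ⟨d, hd⟩ := ht
    exact ⟨c + d, by rw [map_add, hc, hd, TensorProduct.add_tmul]⟩

/-- If `c ∈ JA`, then `c ⊗ u` lies in the image of `A ⊗ J • span {u}`. -/
theorem tmul_mem_range_lTensor_smul_span_singleton {R A M : Type*} [CommRing R] [CommRing A]
    [Algebra R A] [AddCommGroup M] [Module R M] {J : Ideal R} {c : A}
    (hc : c ∈ J.map (algebraMap R A)) (u : M) :
    c ⊗ₜ[R] u ∈ Set.range (LinearMap.lTensor A (J • Submodule.span R {u}).subtype) := by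
  have hc' : c ∈ J • (⊤ : Submodule R A) := by
    rw [Ideal.smul_top_eq_map]; exact hc
  rw [← LinearMap.coe_range, SetLike.mem_coe]
  clear hc
  induction hc' using Submodule.smul_induction_on' with
  | smul j hj a _ =>
    refine ⟨a ⊗ₜ ⟨j • u, Submodule.smul_mem_smul hj (Submodule.mem_span_singleton_self u)⟩, ?_⟩
    simp [TensorProduct.smul_tmul]
  | add a _ b _ ha hb =>
    rw [TensorProduct.add_tmul]
    exact Submodule.add_mem _ ha hb

/-- If `c ⊗ r` vanishes in `A ⊗ R ⧸ J`, then `c r ∈ JA`. -/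
theorem mul_mem_map_of_tmul_mk_eq_zero {R A : Type*} [CommRing R] [CommRing A] [Algebra R A]
    {J : Ideal R} {c : A} {r : R} (h : c ⊗ₜ[R] Ideal.Quotient.mk J r = 0) :
    c * algebraMap R A r ∈ J.map (algebraMap R A) := by
  have h' := congrArg (TensorProduct.tensorQuotEquivQuotSMul A J) h
  rw [map_zero, TensorProduct.tensorQuotEquivQuotSMul_tmul_mk,
    Submodule.Quotient.mk_eq_zero, Ideal.smul_top_eq_map] at h'
  rw [mul_comm, ← Algebra.smul_def]
  exact h'

theorem daggerClosure_colon_capturing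
    (R : Type u) [CommRing R] [IsNoetherianRing R] [IsLocalRing R] [IsDomain R]
    (A : Type v) [CommRing A] [IsLocalRing A] [IsDomain A] [Algebra R A]
    (hinj : Function.Injective (algebraMap R A))
    (v : A → WithTop ℝ) (hv : IsNormalizedValueMap v)
    (hacm : IsAlmostCohenMacaulayAlgebra R A v)
    (k : ℕ) (x : Fin (k + 1) → R)
    (hpsop : ∃ ys : List R, IsSystemOfParameters R (List.ofFn x ++ ys))
    (J : Ideal R) (hJ : J = Ideal.span (Set.range fun i : Fin k => x i.castSucc))
    (M : Type u) [AddCommGroup M] [Module R M] [Module.Finite R M] (u : M)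
    (f : M →ₗ[R] R ⧸ J) (hf : Function.Surjective f)
    (hfu : f u = Ideal.Quotient.mk J (x (Fin.last k))) :
    daggerClosure R A v (Submodule.span R {u}) ∩ (LinearMap.ker f : Set M) ⊆
      daggerClosure R A v (J • Submodule.span R {u}) := by
  rintro z ⟨hz, hfz⟩ ε hε
  obtain ⟨a, ha, haz⟩ := hz (ε / 2) (half_pos hε)
  obtain ⟨c, hc⟩ := exists_tmul_of_mem_range_lTensor_span_singleton haz
  rw [TensorProduct.smul_tmul', smul_eq_mul, mul_one] at hc
  have hcx : c * algebraMap R A (x (Fin.last k)) ∈ J.map (algebraMap R A) := by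
    refine mul_mem_map_of_tmul_mk_eq_zero ?_
    have h := congrArg (LinearMap.lTensor A f) hc
    rw [LinearMap.lTensor_tmul, LinearMap.lTensor_tmul, LinearMap.mem_ker.1 hfz, hfu,
      TensorProduct.tmul_zero] at h
    exact h.symm
  obtain ⟨ys, hys⟩ := hpsop
  have htake : (List.ofFn x ++ ys).take k = List.ofFn fun i : Fin k => x i.castSucc := by
    rw [List.take_append_of_le_length (by simp), List.ofFn_succ', List.concat_eq_append,
      List.take_append_of_le_length (by simp), List.take_of_length_le (by simp)]
  have hspan : Ideal.span (algebraMap R A '' {y | y ∈ (List.ofFn x ++ ys).take k}) =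
      J.map (algebraMap R A) := by
    rw [hJ, Ideal.map_span, htake]
    congr 2
    ext y
    simp [List.mem_ofFn]
  have hget (hk : k < (List.ofFn x ++ ys).length) :
      (List.ofFn x ++ ys).get ⟨k, hk⟩ = x (Fin.last k) := by
    rw [List.get_eq_getElem, List.getElem_append_left (by simp), List.getElem_ofFn]
    rfl
  obtain ⟨b, hb, hbc⟩ := hacm _ hys k (by simp) c
    (by rw [hspan, hget]; exact hcx) (ε / 2) (half_pos hε)
  rw [hspan] at hbc
  refine ⟨b * a, ?_, ?_⟩
  · rw [hv.1.map_mul, ← add_halves ε, WithTop.coe_add]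
    exact WithTop.add_lt_add hb ha
  · have h : (b * a) • ((1 : A) ⊗ₜ[R] z) = (b * c) ⊗ₜ[R] u := by
      have h := congrArg (b • ·) hc
      simpa [TensorProduct.smul_tmul'] using h
    rw [h]
    exact tmul_mem_range_lTensor_smul_span_singleton hbc u
end

section
/- Let (R,𝔪) be a Noetherian local domain, let R^+ be the integral closure of R in an algebraic closure of its fraction field, equipped with a normalized value map v : R^+ → ℝ ∪ {∞}, and let A be a local R^+-algebra. Suppose that 0^𝐯 = 0, i.e., whenever x ∈ R satisfies: for every ε > 0 there exists a ∈ R^+ with v(a) < ε such that a·(x⊗1) = 0 in A, then x = 0. Then the structure map R^+ → A is injective. -/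
theorem algebraMap_absoluteIntegralClosure_injective
    (R : Type u) [CommRing R] [IsNoetherianRing R] [IsLocalRing R] [IsDomain R]
    (K : Type u) [Field K] [Algebra R K] [IsFractionRing R K]
    (L : Type u) [Field L] [Algebra K L] [IsAlgClosure K L]
    [Algebra R L] [IsScalarTower R K L]
    (A : Type v) [CommRing A] [IsLocalRing A]
    [Algebra (integralClosure R L) A]
    (v : integralClosure R L → WithTop ℝ) (hv : IsNormalizedValueMap v)
    (h0 : ∀ x : R,
      (∀ ε : ℝ, 0 < ε → ∃ a : integralClosure R L, v a < (ε : WithTop ℝ) ∧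
        algebraMap (integralClosure R L) A a *
          algebraMap (integralClosure R L) A (algebraMap R (integralClosure R L) x)
            = 0) →
      x = 0) :
    Function.Injective (algebraMap (integralClosure R L) A) := by
  rw [injective_iff_map_eq_zero]
  intro z hz
  by_contra hne
  refine Ideal.comap_ne_bot_of_integral_mem (R := R)
    (I := RingHom.ker (algebraMap (integralClosure R L) A)) hne hz
    (Algebra.IsIntegral.isIntegral z) ((Submodule.eq_bot_iff _).2 fun x hx => ?_)
  refine h0 x fun ε hε => ⟨1, ?_, ?_⟩
  · have h1 : v 1 ≠ ⊤ := fun h => one_ne_zero ((hv.1.eq_top_iff 1).1 h)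
    have h2 : v 1 = v 1 + v 1 := by simpa using hv.1.map_mul 1 1
    lift v 1 to ℝ using h1 with r
    norm_cast at h2 ⊢
    linarith
  · have hx' : algebraMap (integralClosure R L) A
        (algebraMap R (integralClosure R L) x) = 0 := hx
    rw [hx', mul_zero]
end

section
/- Let (R,𝔪) be a complete Noetherian local domain of mixed characteristic p > 0 with system of parameters p, x_2, …, x_d, let R^+ be the integral closure of R in an algebraic closure of its fraction field, with a normalized value map v : R^+ → ℝ ∪ {∞} extending a valuation on R with v(p) < ∞, and let B be an R^+-algebra. If B/𝔪B is not almost zero as an R^+-module, then there exists a positive rational number ε such that p^ε ∉ (p, x_2, …, x_d)B. -/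
theorem IsValueMap.exists_forall_pow_eq_lt {A : Type*} [CommRing A] {v : A → WithTop ℝ}
    (hv : IsValueMap v) {c : A} (hc : v c ≠ ⊤) {ε : ℝ} (hε : 0 < ε) :
    ∃ k : ℕ, 0 < k ∧ ∀ y : A, y ^ k = c → v y < (ε : WithTop ℝ) := by
  obtain ⟨r, hr⟩ := WithTop.ne_top_iff_exists.mp hc
  obtain ⟨n, hn⟩ := exists_nat_gt (r / ε)
  refine ⟨n + 1, n.succ_pos, fun y hy => ?_⟩
  have h := hv.map_pow_succ y n
  rw [hy, ← hr] at h
  have hy_top : v y ≠ ⊤ := by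
    intro ht
    rw [ht, succ_nsmul, WithTop.add_top] at h
    exact WithTop.coe_ne_top h
  obtain ⟨s, hs⟩ := WithTop.ne_top_iff_exists.mp hy_top
  rw [← hs] at h ⊢
  have h' : r = (n + 1) • s := by exact_mod_cast h
  rw [nsmul_eq_mul] at h'
  push_cast at h'
  rw [div_lt_iff₀ hε] at hn
  refine WithTop.coe_lt_coe.mpr ?_
  by_contra! hle
  nlinarith [mul_le_mul_of_nonneg_left hle (by positivity : (0 : ℝ) ≤ (n : ℝ) + 1)]

theorem IsSystemOfParameters.mem_maximalIdeal {R : Type*} [CommRing R] [IsLocalRing R]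
    {xs : List R} (h : IsSystemOfParameters R xs) {x : R} (hx : x ∈ xs) :
    x ∈ IsLocalRing.maximalIdeal R := by
  rw [← IsLocalRing.eq_maximalIdeal h.2]
  exact Ideal.le_radical (Ideal.subset_span hx)

theorem exists_pow_p_eps_not_mem_of_not_almostZero
    (R : Type u) [CommRing R] [IsNoetherianRing R] [IsLocalRing R] [IsDomain R]
    [IsAdicComplete (IsLocalRing.maximalIdeal R) R]
    (p : ℕ) [hp : Fact p.Prime] [CharZero R]
    [CharP (IsLocalRing.ResidueField R) p]
    (d : ℕ) (x : Fin (d + 1) → R)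
    (hsop : IsSystemOfParameters R (List.ofFn x)) (hx0 : x 0 = (p : R))
    (K : Type u) [Field K] [Algebra R K] [IsFractionRing R K]
    (L : Type u) [Field L] [Algebra K L] [IsAlgClosure K L]
    [Algebra R L] [IsScalarTower R K L]
    (v : integralClosure R L → WithTop ℝ) (hv : IsNormalizedValueMap v)
    (hvp : v (algebraMap R (integralClosure R L) (p : R)) ≠ ⊤)
    (B : Type v) [CommRing B] [Algebra (integralClosure R L) B]
    [Algebra R B] [IsScalarTower R (integralClosure R L) B]
    (hnaz : ¬ ∀ b : B, ∀ ε : ℝ, 0 < ε →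
      ∃ a : integralClosure R L, v a < (ε : WithTop ℝ) ∧
        algebraMap (integralClosure R L) B a * b ∈
          Ideal.map (algebraMap R B) (IsLocalRing.maximalIdeal R)) :
    ∃ m k : ℕ, 0 < m ∧ 0 < k ∧
      ∀ y : integralClosure R L,
        y ^ k = algebraMap R (integralClosure R L) ((p : R) ^ m) →
        algebraMap (integralClosure R L) B y ∉
          Ideal.span (algebraMap R B '' Set.range x) := by
  by_contra! hmem
  refine hnaz fun b ε hε => ?_
  obtain ⟨k, hk, hlt⟩ := hv.1.exists_forall_pow_eq_lt hvp hε
  obtain ⟨y, hy, hyI⟩ := hmem 1 k one_pos hk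
  refine ⟨y, hlt y (by rw [hy, pow_one]), Ideal.mul_mem_right _ _ ?_⟩
  refine Ideal.span_le.mpr ?_ hyI
  rintro _ ⟨_, ⟨i, rfl⟩, rfl⟩
  exact Ideal.mem_map_of_mem _ (hsop.mem_maximalIdeal (List.mem_ofFn.mpr ⟨i, rfl⟩))
end
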